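/- arXiv:1808.02695 — 3 statements merged into one kernel-verified Lean document; each statement's English description precedes it below -/
import Mathlib

section
/- Let 𝔏 be a Leibniz algebra over a field K of characteristic zero. Then the Leibniz 3-kernel of U_3(𝔏) is zero (equivalently, the ternary bracket of U_3(𝔏) is totally skew-symmetric, so U_3(𝔏) is a 3-Lie algebra) if and only if [x,[x,y]] = 0 for all x,y ∈ 𝔏. -/
section Defs

variable {K L : Type*}

/-- Right-nested iterated bracket `[x₀,[x₁,[…,[xₙ₋₁,xₙ]…]]]` built from a binary bracket. -/
def nestedBracket (b : L → L → L) : {n : ℕ} → (Fin (n + 1) → L) → L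
  | 0, x => x 0
  | _ + 1, x => b (x 0) (nestedBracket b fun i => x i.succ)

/-- The (right) Leibniz identity for a binary bracket. -/
def IsLeibniz [Add L] (b : L → L → L) : Prop :=
  ∀ x y z, b (b x y) z = b (b x z) y + b x (b y z)

/-- The fundamental identity of a Leibniz `n`-algebra (arity `n + 1`). -/
def LeibnizNIdentity [AddCommMonoid L] {n : ℕ} (br : (Fin (n + 1) → L) → L) : Prop :=
  ∀ (x : Fin (n + 1) → L) (y : Fin n → L),
    br (Fin.cons (br x) y) =
      ∑ i : Fin (n + 1), br (Function.update x i (br (Fin.cons (x i) y)))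

variable [Field K] [AddCommGroup L] [Module K L]

/-- A subspace `I` is an ideal of a Leibniz `n`-algebra: it is an `s`-ideal for every
position `s`, i.e. `[z₁,…,zₙ] ∈ I` whenever some `z_s ∈ I`. -/
def IsNIdeal {n : ℕ} (br : (Fin (n + 1) → L) → L) (I : Submodule K L) : Prop :=
  ∀ (s : Fin (n + 1)) (z : Fin (n + 1) → L), z s ∈ I → br z ∈ I

/-- The Leibniz `n`-kernel: the smallest ideal containing all brackets with a repeated entry. -/
def leibnizNKernel {n : ℕ} (br : (Fin (n + 1) → L) → L) : Submodule K L :=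
  sInf {I : Submodule K L |
    IsNIdeal br I ∧ ∀ z : Fin (n + 1) → L, (∃ i j, i < j ∧ z i = z j) → br z ∈ I}

/-- A subspace `I` is a (two-sided) ideal of a Leibniz algebra. -/
def IsLeibnizIdeal (b : L →ₗ[K] L →ₗ[K] L) (I : Submodule K L) : Prop :=
  (∀ x ∈ I, ∀ y : L, b x y ∈ I) ∧ (∀ x ∈ I, ∀ y : L, b y x ∈ I)

/-- The Leibniz kernel `span {[x,x] : x ∈ L}` of a Leibniz algebra. -/
def leibnizKernel (b : L →ₗ[K] L →ₗ[K] L) : Submodule K L :=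
  Submodule.span K {v : L | ∃ x : L, b x x = v}

/-- The derived series of a subspace of a Leibniz algebra. -/
def derivedSeriesSub (b : L →ₗ[K] L →ₗ[K] L) (S : Submodule K L) : ℕ → Submodule K L
  | 0 => S
  | m + 1 => Submodule.span K
      {v : L | ∃ a ∈ derivedSeriesSub b S m, ∃ c ∈ derivedSeriesSub b S m, b a c = v}

/-- The `k`-derived series `H^{(m+1)_k}` of a subspace of a Leibniz `n`-algebra
(indexed so that index `0` corresponds to `H^{(1)_k} = H`). -/
def kSeries {n : ℕ} (br : (Fin (n + 1) → L) → L) (k : ℕ) (H : Submodule K L) :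
    ℕ → Submodule K L
  | 0 => H
  | p + 1 => Submodule.span K
      {v : L | ∃ z : Fin (n + 1) → L, ∃ s : Finset (Fin (n + 1)),
        k ≤ s.card ∧ (∀ i ∈ s, z i ∈ kSeries br k H p) ∧ br z = v}

end Defs

/-- In a right Leibniz algebra the right-nested bracket `[x,[y,z]]` is skew in `y` and `z`. -/
theorem IsLeibniz.apply_apply_add_swap {L : Type*} [AddCommGroup L] {b : L → L → L}
    (hb : IsLeibniz b) (x y z : L) : b x (b y z) + b x (b z y) = 0 := by
  have h₁ := hb x y z
  rw [hb x z y, add_assoc, left_eq_add, add_comm] at h₁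
  exact h₁

/-- In a right Leibniz algebra every square is annihilated by left multiplications. -/
theorem IsLeibniz.apply_apply_self {L : Type*} [AddCommGroup L] {b : L → L → L}
    (hb : IsLeibniz b) (x y : L) : b x (b y y) = 0 :=
  left_eq_add.mp (hb x y y)

/-- The Leibniz `n`-kernel vanishes iff all brackets with a repeated entry do, provided that the
bracket vanishes as soon as one of its entries does. -/
theorem leibnizNKernel_eq_bot_iff {K L : Type*} [Field K] [AddCommGroup L] [Module K L] {n : ℕ}
    {br : (Fin (n + 1) → L) → L} (h_br : ∀ s z, z s = 0 → br z = 0) :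
    leibnizNKernel (K := K) br = ⊥ ↔ ∀ z, (∃ i j, i < j ∧ z i = z j) → br z = 0 := by
  constructor
  · intro h z hz
    rw [← Submodule.mem_bot K, ← h, leibnizNKernel, Submodule.mem_sInf]
    exact fun I hI => hI.2 z hz
  · intro h
    refine eq_bot_iff.mpr (sInf_le ⟨fun s z hz => ?_, fun z hz => ?_⟩)
    · exact (Submodule.mem_bot K).mpr (h_br s z ((Submodule.mem_bot K).mp hz))
    · exact (Submodule.mem_bot K).mpr (h z hz)

/-- For a Leibniz algebra `𝔏` over a field of characteristic zero, the Leibniz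
`3`-kernel of `U₃(𝔏)` is zero (i.e. `U₃(𝔏)` is a `3`-Lie algebra) if and only if
`[x,[x,y]] = 0` for all `x, y ∈ 𝔏`. -/
theorem stmt_6 {K L : Type*} [Field K] [CharZero K] [AddCommGroup L] [Module K L]
    (b : L →ₗ[K] L →ₗ[K] L) (hb : IsLeibniz fun x y => b x y) :
    leibnizNKernel (K := K) (nestedBracket (n := 2) fun x y => b x y) = ⊥ ↔
      ∀ x y : L, b x (b x y) = 0 := by
  rw [leibnizNKernel_eq_bot_iff]
  · constructor
    · intro h x y
      exact h ![x, x, y] ⟨0, 1, by decide, rfl⟩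
    · rintro h z ⟨i, j, hij, hz⟩
      change b (z 0) (b (z 1) (z 2)) = 0
      fin_cases i <;> fin_cases j <;> simp at hij hz
      · rw [hz, h]
      · have h_swap := hb.apply_apply_add_swap (z 0) (z 0) (z 1)
        rw [← hz]
        rwa [h, zero_add] at h_swap
      · rw [hz]
        exact hb.apply_apply_self _ _
  · intro s z hz
    change b (z 0) (b (z 1) (z 2)) = 0
    fin_cases s <;> simp at hz <;> simp [hz]
end

section
/- Let 𝔏 be a Leibniz algebra over a field K of characteristic zero and n ≥ 2. Then U_n(𝔏) is a simple Leibniz n-algebra (i.e., its n-ary bracket is not identically zero and its only ideals are {0} and 𝔏) if and only if 𝔏 is a simple Lie algebra (i.e., [x,x] = 0 for all x, the bracket is not identically zero, and the only ideals of 𝔏 are {0} and 𝔏). -/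
section Helpers

variable {K L : Type*} [Field K] [AddCommGroup L] [Module K L]

/-- The left inner multiplications kill squares in a right Leibniz algebra. -/
theorem IsLeibniz.apply_self_right {b : L →ₗ[K] L →ₗ[K] L}
    (hb : IsLeibniz fun x y => b x y) (x y : L) : b x (b y y) = 0 := by
  simpa using hb x y y

theorem add_swap_mem_leibnizKernel (b : L →ₗ[K] L →ₗ[K] L) (x y : L) :
    b x y + b y x ∈ leibnizKernel b := by
  have hmem : ∀ z, b z z ∈ leibnizKernel b := fun z => Submodule.subset_span ⟨z, rfl⟩
  have h : b x y + b y x = b (x + y) (x + y) - b x x - b y y := by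
    simp only [map_add, LinearMap.add_apply]
    abel
  rw [h]
  exact sub_mem (sub_mem (hmem _) (hmem _)) (hmem _)

theorem IsLeibniz.apply_leibnizKernel {b : L →ₗ[K] L →ₗ[K] L}
    (hb : IsLeibniz fun x y => b x y) (x : L) {v : L} (hv : v ∈ leibnizKernel b) :
    b x v = 0 := by
  have h : leibnizKernel b ≤ LinearMap.ker (b x) := by
    refine Submodule.span_le.2 ?_
    rintro _ ⟨y, rfl⟩
    exact hb.apply_self_right x y
  exact h hv

theorem IsLeibniz.isLeibnizIdeal_leibnizKernel {b : L →ₗ[K] L →ₗ[K] L}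
    (hb : IsLeibniz fun x y => b x y) : IsLeibnizIdeal b (leibnizKernel b) := by
  refine ⟨fun x hx y => ?_, fun x hx y => ?_⟩
  · have h : leibnizKernel b ≤ (leibnizKernel b).comap (b.flip y) := by
      refine Submodule.span_le.2 ?_
      rintro _ ⟨x, rfl⟩
      have hxy := hb x x y
      simp only at hxy
      simp only [Submodule.comap_coe, Set.mem_preimage, LinearMap.flip_apply, SetLike.mem_coe, hxy]
      exact add_swap_mem_leibnizKernel b _ _
    exact h hx
  · rw [hb.apply_leibnizKernel y hx]
    exact zero_mem _

theorem IsLeibnizIdeal.isNIdeal_nestedBracket {b : L →ₗ[K] L →ₗ[K] L} {I : Submodule K L}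
    (hI : IsLeibnizIdeal b I) (n : ℕ) :
    IsNIdeal (nestedBracket (n := n) fun a c => b a c) I := by
  induction n with
  | zero =>
    intro s z hs
    rwa [Fin.fin_one_eq_zero s] at hs
  | succ n ih =>
    intro s z hs
    cases s using Fin.cases with
    | zero => exact hI.1 _ hs _
    | succ s => exact hI.2 _ (ih s (fun i => z i.succ) hs) _

/-- A nonzero Leibniz algebra bracket without proper ideals is perfect. -/
theorem span_bracket_eq_top {b : L →ₗ[K] L →ₗ[K] L} (hne : ∃ x y : L, b x y ≠ 0)
    (hsimple : ∀ I : Submodule K L, IsLeibnizIdeal b I → I = ⊥ ∨ I = ⊤) :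
    Submodule.span K {v : L | ∃ x y, b x y = v} = ⊤ := by
  have hmem : ∀ x y, b x y ∈ Submodule.span K {v : L | ∃ x y, b x y = v} :=
    fun x y => Submodule.subset_span ⟨x, y, rfl⟩
  refine (hsimple _ ⟨fun x _ y => hmem x y, fun x _ y => hmem y x⟩).resolve_left fun h => ?_
  obtain ⟨x, y, hxy⟩ := hne
  exact hxy (by simpa [h] using hmem x y)

theorem span_range_nestedBracket_eq_top {b : L →ₗ[K] L →ₗ[K] L}
    (hb : Submodule.span K {v : L | ∃ x y, b x y = v} = ⊤) (n : ℕ) :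
    Submodule.span K (Set.range (nestedBracket (n := n) fun a c => b a c)) = ⊤ := by
  induction n with
  | zero =>
    refine eq_top_iff.2 fun v _ => Submodule.subset_span ⟨fun _ => v, rfl⟩
  | succ n ih =>
    rw [eq_top_iff, ← hb, Submodule.span_le]
    rintro _ ⟨x, y, rfl⟩
    have h : (⊤ : Submodule K L) ≤ (Submodule.span K
        (Set.range (nestedBracket (n := n + 1) fun a c => b a c))).comap (b x) := by
      rw [← ih, Submodule.span_le]
      rintro _ ⟨z, rfl⟩
      exact Submodule.subset_span ⟨Fin.cons x z, by simp [nestedBracket]⟩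
    exact h (Submodule.mem_top (x := y))

theorem IsNIdeal.isLeibnizIdeal {b : L →ₗ[K] L →ₗ[K] L} (halt : ∀ x, b x x = 0)
    (hb : Submodule.span K {v : L | ∃ x y, b x y = v} = ⊤) {n : ℕ} {I : Submodule K L}
    (hI : IsNIdeal (nestedBracket (n := n + 1) fun a c => b a c) I) : IsLeibnizIdeal b I := by
  have hleft : ∀ x ∈ I, ∀ y, b x y ∈ I := by
    intro x hx y
    have h : (⊤ : Submodule K L) ≤ I.comap (b x) := by
      rw [← span_range_nestedBracket_eq_top hb n, Submodule.span_le]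
      rintro _ ⟨z, rfl⟩
      simpa [nestedBracket] using hI 0 (Fin.cons x z) hx
    exact h (Submodule.mem_top (x := y))
  refine ⟨hleft, fun x hx y => ?_⟩
  rw [← LinearMap.IsAlt.neg (B := b) halt]
  exact neg_mem (hleft x hx y)

end Helpers

/-- For a Leibniz algebra `𝔏` over a field of characteristic zero and `n ≥ 2`
(arity `n + 1`, `1 ≤ n`), `U_n(𝔏)` is a simple Leibniz `n`-algebra (nonzero bracket, only
ideals `⊥` and `⊤`) if and only if `𝔏` is a simple Lie algebra (`[x,x] = 0`, nonzero
bracket, only ideals `⊥` and `⊤`). -/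
theorem stmt_12 {K L : Type*} [Field K] [CharZero K] [AddCommGroup L] [Module K L]
    (b : L →ₗ[K] L →ₗ[K] L) (hb : IsLeibniz fun x y => b x y)
    (n : ℕ) (hn : 1 ≤ n) :
    ((∃ x : Fin (n + 1) → L, nestedBracket (fun a c => b a c) x ≠ 0) ∧
        ∀ I : Submodule K L,
          IsNIdeal (nestedBracket (n := n) fun a c => b a c) I → I = ⊥ ∨ I = ⊤) ↔
      ((∀ x : L, b x x = 0) ∧ (∃ x y : L, b x y ≠ 0) ∧
        ∀ I : Submodule K L, IsLeibnizIdeal b I → I = ⊥ ∨ I = ⊤) := by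
  obtain ⟨n, rfl⟩ := Nat.exists_eq_add_of_le' hn
  constructor
  · rintro ⟨⟨x, hx⟩, hsimple⟩
    have hne : b (x 0) (nestedBracket (fun a c => b a c) fun i => x i.succ) ≠ 0 := hx
    have hideal : ∀ I : Submodule K L, IsLeibnizIdeal b I → I = ⊥ ∨ I = ⊤ :=
      fun I hI => hsimple I (hI.isNIdeal_nestedBracket _)
    refine ⟨fun y => ?_, ⟨_, _, hne⟩, hideal⟩
    have hker : leibnizKernel b = ⊥ :=
      (hideal _ hb.isLeibnizIdeal_leibnizKernel).resolve_right fun htop =>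
        hne (hb.apply_leibnizKernel _ (htop ▸ Submodule.mem_top))
    have hy : b y y ∈ leibnizKernel b := Submodule.subset_span ⟨y, rfl⟩
    simpa [hker] using hy
  · rintro ⟨halt, hne, hsimple⟩
    have hperf := span_bracket_eq_top hne hsimple
    refine ⟨?_, fun I hI => hsimple I (hI.isLeibnizIdeal halt hperf)⟩
    by_contra! hzero
    have hspan := span_range_nestedBracket_eq_top hperf (n + 1)
    have hbot : (⊤ : Submodule K L) ≤ ⊥ := by
      rw [← hspan, Submodule.span_le]
      rintro _ ⟨z, rfl⟩
      exact hzero z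
    obtain ⟨x, y, hxy⟩ := hne
    exact hxy (hbot Submodule.mem_top)
end

section
/- Let 𝔏 be a Leibniz algebra over a field K of characteristic zero, n ≥ 2, and let I be an ideal of 𝔏. In the Leibniz n-algebra U_n(𝔏) define I^{(1)_2} = I and I^{(m+1)_2} = span{[z_1,...,z_n] : z_1,...,z_n ∈ 𝔏 and z_i ∈ I^{(m)_2} for at least 2 indices i}, and let D^0(I) = I, D^{m+1}(I) = span{[a,b] : a,b ∈ D^m(I)} be the derived series of I in 𝔏. Then I^{(m+1)_2} ⊆ D^m(I) for all m ≥ 0; in particular, if I is solvable in 𝔏 then I is a 2-solvable ideal of U_n(𝔏). -/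
section Ideals

variable {K L : Type*} [Field K] [AddCommGroup L] [Module K L]

/-- In a Leibniz algebra, the span of the brackets of elements of an ideal is an ideal. -/
theorem IsLeibnizIdeal.span_bracket {b : L →ₗ[K] L →ₗ[K] L} (hb : IsLeibniz fun x y => b x y)
    {A : Submodule K L} (hA : IsLeibnizIdeal b A) :
    IsLeibnizIdeal b (Submodule.span K {v : L | ∃ a ∈ A, ∃ c ∈ A, b a c = v}) := by
  have mem : ∀ {a c : L}, a ∈ A → c ∈ A →
      b a c ∈ Submodule.span K {v : L | ∃ a ∈ A, ∃ c ∈ A, b a c = v} :=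
    fun ha hc => Submodule.subset_span ⟨_, ha, _, hc, rfl⟩
  have leibniz : ∀ x y z, b (b x y) z = b (b x z) y + b x (b y z) := hb
  constructor
  · intro x hx y
    induction hx using Submodule.span_induction with
    | mem x h =>
      obtain ⟨a, ha, c, hc, rfl⟩ := h
      rw [leibniz]
      exact add_mem (mem (hA.1 a ha y) hc) (mem ha (hA.1 c hc y))
    | zero => simp
    | add u v _ _ hu hv => simpa using add_mem hu hv
    | smul r u _ hu => simpa using Submodule.smul_mem _ r hu
  · intro x hx y
    induction hx using Submodule.span_induction with
    | mem x h =>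
      obtain ⟨a, ha, c, hc, rfl⟩ := h
      rw [← sub_eq_of_eq_add' (leibniz y a c)]
      exact sub_mem (mem (hA.2 a ha y) hc) (mem (hA.2 c hc y) ha)
    | zero => simp
    | add u v _ _ hu hv => simpa using add_mem hu hv
    | smul r u _ hu => simpa using Submodule.smul_mem _ r hu

/-- The terms of the derived series of an ideal are ideals. -/
theorem IsLeibnizIdeal.isLeibnizIdeal_derivedSeriesSub {b : L →ₗ[K] L →ₗ[K] L}
    (hb : IsLeibniz fun x y => b x y) {I : Submodule K L} (hI : IsLeibnizIdeal b I) (p : ℕ) :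
    IsLeibnizIdeal b (derivedSeriesSub b I p) := by
  induction p with
  | zero => exact hI
  | succ p ih => exact ih.span_bracket hb

/-- An ideal of a Leibniz algebra is an ideal for the nested bracket. -/
theorem IsLeibnizIdeal.isNIdeal {b : L →ₗ[K] L →ₗ[K] L} {A : Submodule K L}
    (hA : IsLeibnizIdeal b A) (n : ℕ) :
    IsNIdeal (nestedBracket (n := n) fun x y => b x y) A := by
  induction n with
  | zero =>
    intro s z hz
    rwa [show s = 0 by omega] at hz
  | succ n ih =>
    intro s z hz
    cases s using Fin.cases with
    | zero => exact hA.1 _ hz _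
    | succ s => exact hA.2 _ (ih s (fun i => z i.succ) hz) _

/-- A nested bracket with two entries in an ideal `A` lies in the span of the brackets of
elements of `A`. -/
theorem IsLeibnizIdeal.nestedBracket_mem_span {b : L →ₗ[K] L →ₗ[K] L}
    (hb : IsLeibniz fun x y => b x y) {A : Submodule K L} (hA : IsLeibnizIdeal b A) {n : ℕ}
    (z : Fin (n + 1) → L) {i j : Fin (n + 1)} (hij : i < j) (hi : z i ∈ A) (hj : z j ∈ A) :
    nestedBracket (fun x y => b x y) z ∈
      Submodule.span K {v : L | ∃ a ∈ A, ∃ c ∈ A, b a c = v} := by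
  induction n with
  | zero => omega
  | succ n ih =>
    cases j using Fin.cases with
    | zero => exact absurd hij (Fin.not_lt_zero i)
    | succ j =>
      cases i using Fin.cases with
      | zero =>
        exact Submodule.subset_span
          ⟨_, hi, _, hA.isNIdeal n j (fun k => z k.succ) hj, rfl⟩
      | succ i =>
        exact (hA.span_bracket hb).2 _
          (ih (fun k => z k.succ) (Fin.succ_lt_succ_iff.mp hij) hi hj) _

/-- The `2`-derived series of an ideal for the nested bracket is contained in its derived
series. -/
theorem IsLeibnizIdeal.kSeries_two_le {b : L →ₗ[K] L →ₗ[K] L}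
    (hb : IsLeibniz fun x y => b x y) {I : Submodule K L} (hI : IsLeibnizIdeal b I)
    (n p : ℕ) :
    kSeries (nestedBracket (n := n) fun x y => b x y) 2 I p ≤ derivedSeriesSub b I p := by
  induction p with
  | zero => exact le_rfl
  | succ p ih =>
    refine Submodule.span_le.mpr ?_
    rintro _ ⟨z, s, hs, hz, rfl⟩
    obtain ⟨i, hi, j, hj, hij⟩ := Finset.one_lt_card.mp hs
    have hp := hI.isLeibnizIdeal_derivedSeriesSub hb p
    rcases lt_or_gt_of_ne hij with h | h
    · exact hp.nestedBracket_mem_span hb z h (ih (hz i hi)) (ih (hz j hj))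
    · exact hp.nestedBracket_mem_span hb z h (ih (hz j hj)) (ih (hz i hi))

end Ideals

/-- For a Leibniz algebra `𝔏` over a field of characteristic zero, `n ≥ 2`
(arity `n + 1`, `1 ≤ n`), and an ideal `I` of `𝔏`: the `2`-derived series of `I` in
`U_n(𝔏)` is contained in the derived series of `I` in `𝔏` (`I^{(m+1)₂} ⊆ D^m(I)`, with our
index `p` corresponding to `I^{(p+1)₂}` and `D^p(I)`); in particular if `I` is solvable in
`𝔏` then `I` is a `2`-solvable ideal of `U_n(𝔏)`. -/
theorem stmt_17 {K L : Type*} [Field K] [CharZero K] [AddCommGroup L] [Module K L]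
    (b : L →ₗ[K] L →ₗ[K] L) (hb : IsLeibniz fun x y => b x y)
    (n : ℕ) (hn : 1 ≤ n)
    (I : Submodule K L) (hI : IsLeibnizIdeal b I) :
    (∀ p : ℕ, kSeries (nestedBracket (n := n) fun x y => b x y) 2 I p ≤
        derivedSeriesSub b I p) ∧
      ((∃ p, derivedSeriesSub b I p = ⊥) →
        IsNIdeal (nestedBracket (n := n) fun x y => b x y) I ∧
          ∃ p, kSeries (nestedBracket (n := n) fun x y => b x y) 2 I p = ⊥) := by
  refine ⟨hI.kSeries_two_le hb n, ?_⟩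
  rintro ⟨p, hp⟩
  exact ⟨hI.isNIdeal n, p, le_bot_iff.mp (hp ▸ hI.kSeries_two_le hb n p)⟩
end
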